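/- Let m_1,…,m_n be a minimal generating set of a monomial ideal I of R and let 1 ≤ i < j < k ≤ n. Suppose the monomial m_{ijk}/m_{ij} has positive exponent in two distinct variables. Then: (a) m_{ijk}/m_{ik} and m_{ijk}/m_{jk} are both powers of the remaining third variable; (b) m_{ik} divides m_{jk} or m_{jk} divides m_{ik}; and (c) either m_{ik} = m_{jk}, or σ_{ik} ∈ 𝔪Z₂, or σ_{jk} ∈ 𝔪Z₂. -/

import Mathlib

open MvPolynomial

noncomputable section

/-- The trivariate polynomial ring `K[x,y,z]`, with variables indexed by `Fin 3`. -/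
abbrev PR (K : Type*) [Field K] : Type _ := MvPolynomial (Fin 3) K

/-- The monomial of `K[x,y,z]` with exponent vector `a : Fin 3 → ℕ`. -/
noncomputable def monom (K : Type*) [Field K] (a : Fin 3 → ℕ) : PR K :=
  ∏ t, X t ^ a t

/-- `m 0, …, m (n-1)` (given by their exponent vectors) form a minimal generating set of the
monomial ideal they generate: they are pairwise distinct and no one divides another.
(Divisibility of monomials is pointwise `≤` of exponent vectors, so non-divisibility for all
pairs of distinct indices already implies distinctness.) -/
def MinGen {n : ℕ} (m : Fin n → Fin 3 → ℕ) : Prop :=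
  ∀ i j, i ≠ j → ¬ m i ≤ m j

/-- Strict divisibility of monomials, in terms of exponent vectors: `a` divides `b` and `a ≠ b`. -/
def strictDvd (a b : Fin 3 → ℕ) : Prop := a ≤ b ∧ a ≠ b

/-- Strong divisibility of monomials: `a` divides `b / x_t` for every variable `x_t`
dividing `b`. -/
def strongDvd (a b : Fin 3 → ℕ) : Prop :=
  ∀ t, 0 < b t → a ≤ b - Pi.single t 1

/-- A monomial ideal (given by the exponent vectors of its minimal generators) is generic if
whenever two distinct minimal generators have the same positive exponent in some variable,
a third minimal generator strongly divides their lcm. -/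
def GenericI {n : ℕ} (m : Fin n → Fin 3 → ℕ) : Prop :=
  ∀ i j, i ≠ j → (∃ t, 0 < m i t ∧ m i t = m j t) →
    ∃ l, l ≠ i ∧ l ≠ j ∧ strongDvd (m l) (m i ⊔ m j)

/-- The homogeneous maximal ideal `𝔪 = (x,y,z)` of `K[x,y,z]`. -/
noncomputable def mxIdeal (K : Type*) [Field K] : Ideal (PR K) :=
  Ideal.span (Set.range X)

/-- The `R`-linear map `f₁ : Rⁿ → R` sending the `i`-th standard basis vector to the
monomial `m_i`. -/
noncomputable def syzF1 (K : Type*) [Field K] {n : ℕ} (m : Fin n → Fin 3 → ℕ) :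
    (Fin n → PR K) →ₗ[PR K] PR K where
  toFun v := ∑ i, v i * monom K (m i)
  map_add' u v := by simp [add_mul, Finset.sum_add_distrib]
  map_smul' c v := by simp [Finset.mul_sum, mul_assoc]

/-- The module `Z₂ = ker f₁` of second syzygies of `R/I`. -/
noncomputable def Z2 (K : Type*) [Field K] {n : ℕ} (m : Fin n → Fin 3 → ℕ) :
    Submodule (PR K) (Fin n → PR K) :=
  LinearMap.ker (syzF1 K m)

/-- The S-pair `σ_{ij} = (m_{ij}/m_j)·e_j − (m_{ij}/m_i)·e_i ∈ Rⁿ`. -/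
noncomputable def sigmaS (K : Type*) [Field K] {n : ℕ} (m : Fin n → Fin 3 → ℕ)
    (i j : Fin n) : Fin n → PR K :=
  Pi.single j (monom K ((m i ⊔ m j) - m j)) - Pi.single i (monom K ((m i ⊔ m j) - m i))

/-- `τ_{ijl} = (m_{ijl}/m_{ij})·e_{ij} − (m_{ijl}/m_{il})·e_{il} + (m_{ijl}/m_{jl})·e_{jl}`,
an element of the free module `F₂` with basis `e_{pq}` indexed by pairs. -/
noncomputable def tauS (K : Type*) [Field K] {n : ℕ} (m : Fin n → Fin 3 → ℕ)
    (i j l : Fin n) : Fin n × Fin n → PR K :=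
  Pi.single (i, j) (monom K ((m i ⊔ m j ⊔ m l) - (m i ⊔ m j)))
    - Pi.single (i, l) (monom K ((m i ⊔ m j ⊔ m l) - (m i ⊔ m l)))
    + Pi.single (j, l) (monom K ((m i ⊔ m j ⊔ m l) - (m j ⊔ m l)))

/-- The submodule `Z₃` of `F₂` generated by all `τ_{abc}` with `a < b < c`. -/
noncomputable def Z3 (K : Type*) [Field K] {n : ℕ} (m : Fin n → Fin 3 → ℕ) :
    Submodule (PR K) (Fin n × Fin n → PR K) :=
  Submodule.span (PR K) {v | ∃ a b c : Fin n, a < b ∧ b < c ∧ v = tauS K m a b c}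

theorem monom_add (K : Type*) [Field K] (a b : Fin 3 → ℕ) :
    monom K (a + b) = monom K a * monom K b := by
  simp [monom, pow_add, Finset.prod_mul_distrib]

theorem monom_sub_mul_monom_sub (K : Type*) [Field K] {a b c : Fin 3 → ℕ}
    (hab : a ≤ b) (hbc : b ≤ c) :
    monom K (c - b) * monom K (b - a) = monom K (c - a) := by
  rw [← monom_add]
  congr 1
  funext t
  have h₁ : a t ≤ b t := hab t
  have h₂ : b t ≤ c t := hbc t
  simp only [Pi.add_apply, Pi.sub_apply]
  omega

theorem monom_mem_mxIdeal (K : Type*) [Field K] {a : Fin 3 → ℕ} {t : Fin 3} (h : 0 < a t) :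
    monom K a ∈ mxIdeal K :=
  Ideal.mem_of_dvd _
    ((dvd_pow_self _ h.ne').trans
      (Finset.dvd_prod_of_mem (fun t => (X t : PR K) ^ a t) (Finset.mem_univ t)))
    (Ideal.subset_span (Set.mem_range_self t))

theorem sigmaS_mem_Z2 (K : Type*) [Field K] {n : ℕ} (m : Fin n → Fin 3 → ℕ) (i j : Fin n) :
    sigmaS K m i j ∈ Z2 K m := by
  have hsingle (p : Fin n) (f : PR K) : syzF1 K m (Pi.single p f) = f * monom K (m p) := by
    simp [syzF1, Pi.single_apply]
  rw [Z2, LinearMap.mem_ker, sigmaS, map_sub, hsingle, hsingle, ← monom_add, ← monom_add,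
    tsub_add_cancel_of_le le_sup_left, tsub_add_cancel_of_le le_sup_right, sub_self]

/-- If `m p` divides `m_{qr}`, then `σ_{qr}` is a monomial combination of `σ_{pr}` and
`σ_{qp}`. -/
theorem sigmaS_eq_add (K : Type*) [Field K] {n : ℕ} (m : Fin n → Fin 3 → ℕ) {p q r : Fin n}
    (h : m p ≤ m q ⊔ m r) :
    sigmaS K m q r =
      monom K ((m q ⊔ m r) - (m p ⊔ m r)) • sigmaS K m p r +
        monom K ((m q ⊔ m r) - (m q ⊔ m p)) • sigmaS K m q p := by
  have hpr : m p ⊔ m r ≤ m q ⊔ m r := sup_le h le_sup_right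
  have hqp : m q ⊔ m p ≤ m q ⊔ m r := sup_le le_sup_left h
  simp only [sigmaS, smul_sub, ← Pi.single_smul', smul_eq_mul,
    monom_sub_mul_monom_sub K le_sup_right hpr, monom_sub_mul_monom_sub K le_sup_left hpr,
    monom_sub_mul_monom_sub K le_sup_right hqp, monom_sub_mul_monom_sub K le_sup_left hqp]
  abel

theorem sigmaS_mem_mxIdeal_smul_Z2 (K : Type*) [Field K] {n : ℕ} (m : Fin n → Fin 3 → ℕ)
    {p q r : Fin n} (h : m p ≤ m q ⊔ m r) {s t : Fin 3}
    (hs : (m p ⊔ m r) s < (m q ⊔ m r) s) (ht : (m q ⊔ m p) t < (m q ⊔ m r) t) :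
    sigmaS K m q r ∈ mxIdeal K • Z2 K m := by
  rw [sigmaS_eq_add K m h]
  exact add_mem
    (Submodule.smul_mem_smul (monom_mem_mxIdeal K (Nat.sub_pos_of_lt hs)) (sigmaS_mem_Z2 K m p r))
    (Submodule.smul_mem_smul (monom_mem_mxIdeal K (Nat.sub_pos_of_lt ht)) (sigmaS_mem_Z2 K m q p))

/-- Suppose `m_{ijl}/m_{ij}` has positive exponent in two distinct variables
`t₁ ≠ t₂`. Then (a) `m_{ijl}/m_{il}` and `m_{ijl}/m_{jl}` are powers of the remaining third
variable (i.e. their exponents at `t₁` and `t₂` vanish); (b) `m_{il}` divides `m_{jl}` or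
`m_{jl}` divides `m_{il}`; and (c) either `m_{il} = m_{jl}`, or `σ_{il} ∈ 𝔪Z₂`, or
`σ_{jl} ∈ 𝔪Z₂`. -/
theorem stmt18 (K : Type*) [Field K] {n : ℕ} (m : Fin n → Fin 3 → ℕ) (hm : MinGen m)
    (i j l : Fin n) (hij : i < j) (hjl : j < l)
    (t₁ t₂ : Fin 3) (ht : t₁ ≠ t₂)
    (h1 : 0 < ((m i ⊔ m j ⊔ m l) - (m i ⊔ m j)) t₁)
    (h2 : 0 < ((m i ⊔ m j ⊔ m l) - (m i ⊔ m j)) t₂) :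
    (((m i ⊔ m j ⊔ m l) - (m i ⊔ m l)) t₁ = 0 ∧
       ((m i ⊔ m j ⊔ m l) - (m i ⊔ m l)) t₂ = 0 ∧
       ((m i ⊔ m j ⊔ m l) - (m j ⊔ m l)) t₁ = 0 ∧
       ((m i ⊔ m j ⊔ m l) - (m j ⊔ m l)) t₂ = 0) ∧
    (m i ⊔ m l ≤ m j ⊔ m l ∨ m j ⊔ m l ≤ m i ⊔ m l) ∧
    (m i ⊔ m l = m j ⊔ m l ∨ sigmaS K m i l ∈ mxIdeal K • Z2 K m ∨
       sigmaS K m j l ∈ mxIdeal K • Z2 K m) := by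
  simp only [Pi.sub_apply, Pi.sup_apply] at h1 h2
  obtain ⟨t₃, hcover⟩ : ∃ t₃ : Fin 3, ∀ t, t = t₁ ∨ t = t₂ ∨ t = t₃ := by
    clear h1 h2
    decide +revert
  have sup_le_sup_of_le {p q : Fin n} (hp₁ : m p t₁ ≤ m l t₁) (hp₂ : m p t₂ ≤ m l t₂)
      (hpq : m p t₃ ≤ m q t₃) : m p ⊔ m l ≤ m q ⊔ m l := by
    intro t
    simp only [Pi.sup_apply]
    rcases hcover t with rfl | rfl | rfl <;> omega
  have eq_or_mem {p q : Fin n} (hle : m p ⊔ m l ≤ m q ⊔ m l)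
      (hlt : (m q ⊔ m p) t₁ < (m q ⊔ m l) t₁) :
      m p ⊔ m l = m q ⊔ m l ∨ sigmaS K m q l ∈ mxIdeal K • Z2 K m := by
    rcases hle.eq_or_lt with heq | hne
    · exact Or.inl heq
    · obtain ⟨s, hs⟩ := (Pi.lt_def.mp hne).2
      exact Or.inr (sigmaS_mem_mxIdeal_smul_Z2 K m (le_sup_left.trans hle) hs hlt)
  refine ⟨by simp only [Pi.sub_apply, Pi.sup_apply]; omega, ?_⟩
  rcases le_total (m i t₃) (m j t₃) with h | h
  · have hle : m i ⊔ m l ≤ m j ⊔ m l := sup_le_sup_of_le (by omega) (by omega) h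
    have hmem := eq_or_mem hle (by simp only [Pi.sup_apply]; omega)
    exact ⟨Or.inl hle, hmem.imp_right Or.inr⟩
  · have hle : m j ⊔ m l ≤ m i ⊔ m l := sup_le_sup_of_le (by omega) (by omega) h
    have hmem := eq_or_mem hle (by simp only [Pi.sup_apply]; omega)
    exact ⟨Or.inr hle, hmem.imp Eq.symm Or.inl⟩
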